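/- Let l be a prime number and let K be a finite field extension of the l-adic field ℚ_l of degree d = [K:ℚ_l]. If K contains a primitive l-th root of unity, then the quotient group Kˣ/(Kˣ)^l is finite of cardinality l^(2+d). -/

import Mathlib

/-- If `H` is a finite index subgroup of a commutative group `G` without `n`-torsion, then
`[G : Gⁿ] = [H : Hⁿ] * |G[n]|`. -/
theorem Subgroup.index_range_powMonoidHom_of_finiteIndex {G : Type*} [CommGroup G] (n : ℕ)
    (H : Subgroup G) [H.FiniteIndex] (hH : H ⊓ (powMonoidHom n : G →* G).ker = ⊥) :
    (powMonoidHom n : G →* G).range.index =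
      (H.map (powMonoidHom n)).relIndex H * Nat.card (powMonoidHom n : G →* G).ker := by
  set P : G →* G := powMonoidHom n
  have hle : H.map P ≤ H := by
    rintro _ ⟨h, hh, rfl⟩
    exact H.pow_mem hh n
  have h1 : (H.map P).relIndex H * H.index = (H ⊔ P.ker).index * P.range.index := by
    rw [relIndex_mul_index hle, index_map]
  have h2 : Nat.card P.ker * (H ⊔ P.ker).index = H.index := by
    rw [← relIndex_mul_index (le_sup_left : H ≤ H ⊔ P.ker), relIndex_sup_left,
      ← inf_relIndex_right, hH, relIndex_bot_left]
  have h3 : (H ⊔ P.ker).index ≠ 0 := by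
    intro h
    rw [h, mul_zero] at h2
    exact FiniteIndex.index_ne_zero h2.symm
  rw [← h2] at h1
  exact mul_left_cancel₀ h3 (by rw [← h1]; ring)

theorem MonoidHom.map_range_powMonoidHom {A G : Type*} [CommGroup A] [CommGroup G] (φ : A →* G)
    (n : ℕ) : φ.range.map (powMonoidHom n) = (powMonoidHom n : A →* A).range.map φ := by
  rw [← MonoidHom.range_comp, ← MonoidHom.range_comp]
  congr 1
  ext a
  simp

/-- If a commutative group `A` without `n`-torsion embeds with finite index into `G`, then
`[G : Gⁿ] = [A : Aⁿ] * |G[n]|`. -/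
theorem MonoidHom.index_range_powMonoidHom_of_injective {A G : Type*} [CommGroup A] [CommGroup G]
    (n : ℕ) (φ : A →* G) (hφ : Function.Injective φ) [φ.range.FiniteIndex]
    (hA : ∀ a : A, a ^ n = 1 → a = 1) :
    (powMonoidHom n : G →* G).range.index =
      (powMonoidHom n : A →* A).range.index * Nat.card (powMonoidHom n : G →* G).ker := by
  rw [Subgroup.index_range_powMonoidHom_of_finiteIndex n φ.range, φ.map_range_powMonoidHom]
  · rw [φ.range_eq_map, Subgroup.relIndex_map_map_of_injective _ _ hφ, Subgroup.relIndex_top_right]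
  · rw [eq_bot_iff]
    rintro _ ⟨⟨a, rfl⟩, ha⟩
    have : φ (a ^ n) = φ 1 := by simpa using ha
    simp [hA a (hφ this)]

theorem index_range_powMonoidHom_prod {A B : Type*} [CommGroup A] [CommGroup B] (n : ℕ) :
    (powMonoidHom n : A × B →* A × B).range.index =
      (powMonoidHom n : A →* A).range.index * (powMonoidHom n : B →* B).range.index := by
  rw [← Subgroup.index_prod]
  congr 1
  ext ⟨a, b⟩
  simp [Subgroup.mem_prod, MonoidHom.mem_range]

theorem index_range_powMonoidHom_multiplicative_int (n : ℕ) :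
    (powMonoidHom n : Multiplicative ℤ →* Multiplicative ℤ).range.index = n := by
  have : (powMonoidHom n : Multiplicative ℤ →* Multiplicative ℤ).range =
      (AddSubgroup.zmultiples (n : ℤ)).toSubgroup := by
    ext x
    simp only [MonoidHom.mem_range, powMonoidHom_apply]
    change _ ↔ Multiplicative.toAdd x ∈ AddSubgroup.zmultiples (n : ℤ)
    rw [Int.mem_zmultiples_iff]
    constructor
    · rintro ⟨y, rfl⟩
      exact ⟨y.toAdd, by simp⟩
    · rintro ⟨k, hk⟩
      exact ⟨.ofAdd k, Multiplicative.toAdd.injective (by simp [hk])⟩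
  rw [this, AddSubgroup.index_toSubgroup, Int.index_zmultiples, Int.natAbs_natCast]

section Ultrametric

variable {K : Type*} [NormedField K] [IsUltrametricDist K]

theorem norm_eq_one_of_norm_sub_one_lt_one {x : K} (hx : ‖x - 1‖ < 1) : ‖x‖ = 1 := by
  have := IsUltrametricDist.norm_add_eq_max_of_norm_ne_norm (x := x - 1) (y := 1)
    (by rw [norm_one]; exact hx.ne)
  simpa [hx.le] using this

theorem norm_one_add_pow_sub_le (n : ℕ) {t : K} (ht : ‖t‖ ≤ 1) :
    ‖(1 + t) ^ n - 1 - n * t‖ ≤ ‖t‖ ^ 2 := by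
  induction n with
  | zero => simp
  | succ n ih =>
    have h : (1 + t) ^ (n + 1) - 1 - (n + 1 : ℕ) * t =
        ((1 + t) ^ n - 1 - n * t) * (1 + t) + n * t ^ 2 := by push_cast; ring
    have h1 : ‖1 + t‖ ≤ 1 :=
      (IsUltrametricDist.norm_add_le_max _ _).trans (by simpa using ht)
    rw [h]
    refine (IsUltrametricDist.norm_add_le_max _ _).trans (max_le ?_ ?_)
    · rw [norm_mul]
      exact (mul_le_of_le_one_right (norm_nonneg _) h1).trans ih
    · rw [norm_mul, norm_pow]
      exact mul_le_of_le_one_left (by positivity) (IsUltrametricDist.norm_natCast_le_one K n)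

/-- The group of units `u` with `‖u - 1‖ < 1` and `‖u - 1‖ ≤ ‖π‖ ^ m`. -/
def principalUnits (π : K) (m : ℕ) : Subgroup Kˣ where
  carrier := {u | ‖(u : K) - 1‖ < 1 ∧ ‖(u : K) - 1‖ ≤ ‖π‖ ^ m}
  one_mem' := by simp
  mul_mem' := by
    rintro u v ⟨hu, hu'⟩ ⟨hv, hv'⟩
    have h : ((u * v : Kˣ) : K) - 1 = (u - 1) * v + (v - 1) := by push_cast; ring
    have h1 : ‖((u * v : Kˣ) : K) - 1‖ ≤ max ‖(u : K) - 1‖ ‖(v : K) - 1‖ := by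
      rw [h]
      refine (IsUltrametricDist.norm_add_le_max _ _).trans ?_
      rw [norm_mul, norm_eq_one_of_norm_sub_one_lt_one hv, mul_one]
    exact ⟨h1.trans_lt (max_lt hu hv), h1.trans (max_le hu' hv')⟩
  inv_mem' := by
    rintro u ⟨hu, hu'⟩
    have h : ((u⁻¹ : Kˣ) : K) - 1 = -(u - 1) * (u : K)⁻¹ := by
      rw [Units.val_inv_eq_inv_val]
      field_simp
      ring
    have h1 : ‖((u⁻¹ : Kˣ) : K) - 1‖ = ‖(u : K) - 1‖ := by
      rw [h, norm_mul, norm_neg, norm_inv, norm_eq_one_of_norm_sub_one_lt_one hu, inv_one, mul_one]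
    exact ⟨h1 ▸ hu, h1 ▸ hu'⟩

theorem mem_principalUnits {π : K} {m : ℕ} {u : Kˣ} :
    u ∈ principalUnits π m ↔ ‖(u : K) - 1‖ < 1 ∧ ‖(u : K) - 1‖ ≤ ‖π‖ ^ m := Iff.rfl

theorem mem_principalUnits_of_norm_lt_one {π : K} (hπ : ‖π‖ < 1) {m : ℕ} (hm : m ≠ 0) {u : Kˣ} :
    u ∈ principalUnits π m ↔ ‖(u : K) - 1‖ ≤ ‖π‖ ^ m :=
  ⟨fun h ↦ h.2, fun h ↦ ⟨h.trans_lt (pow_lt_one₀ (norm_nonneg _) hπ hm), h⟩⟩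

theorem norm_eq_one_of_mem_principalUnits {π : K} {m : ℕ} {u : Kˣ} (hu : u ∈ principalUnits π m) :
    ‖(u : K)‖ = 1 :=
  norm_eq_one_of_norm_sub_one_lt_one hu.1

theorem principalUnits_le {π : K} (hπ : ‖π‖ ≤ 1) {m n : ℕ} (h : m ≤ n) :
    principalUnits π n ≤ principalUnits π m :=
  fun _ hu ↦ ⟨hu.1, hu.2.trans (pow_le_pow_of_le_one (norm_nonneg _) hπ h)⟩

section NatCast

variable {l : ℕ}

theorem pow_mem_principalUnits (hl : ‖(l : K)‖ < 1) {m : ℕ} (hm : m ≠ 0) {u : Kˣ}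
    (hu : u ∈ principalUnits (l : K) m) :
    u ^ l ∈ principalUnits (l : K) (m + 1) := by
  rw [mem_principalUnits_of_norm_lt_one hl m.succ_ne_zero]
  obtain ⟨hu1, hu⟩ := hu
  have h := norm_one_add_pow_sub_le l hu1.le
  have h1 : ((u ^ l : Kˣ) : K) - 1 =
      ((1 + ((u : K) - 1)) ^ l - 1 - l * ((u : K) - 1)) + l * ((u : K) - 1) := by push_cast; ring
  rw [h1]
  refine (IsUltrametricDist.norm_add_le_max _ _).trans (max_le (h.trans ?_) ?_)
  · calc ‖(u : K) - 1‖ ^ 2 ≤ (‖(l : K)‖ ^ m) ^ 2 := by gcongr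
      _ = ‖(l : K)‖ ^ (m * 2) := (pow_mul _ _ _).symm
      _ ≤ _ := pow_le_pow_of_le_one (norm_nonneg _) hl.le (by lia)
  · rw [norm_mul, pow_succ']
    gcongr

theorem eq_one_of_mem_principalUnits_of_pow_eq_one (hl0 : (l : K) ≠ 0) (hl : ‖(l : K)‖ < 1)
    {u : Kˣ} (hu : u ∈ principalUnits (l : K) 2) (h1 : u ^ l = 1) : u = 1 := by
  obtain ⟨hu1, hu⟩ := hu
  have h := norm_one_add_pow_sub_le l hu1.le
  have h2 : (u : K) ^ l = 1 := by simpa using congrArg Units.val h1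
  rw [add_sub_cancel, h2, sub_self, zero_sub, norm_neg, norm_mul] at h
  have h0 : 0 < ‖(l : K)‖ := norm_pos_iff.2 hl0
  by_contra hne
  have ht : 0 < ‖(u : K) - 1‖ :=
    norm_pos_iff.2 fun h ↦ hne (Units.ext (by simpa [sub_eq_zero] using h))
  nlinarith [le_of_mul_le_mul_right (by simpa [sq] using h) ht]

theorem exists_div_pow_mem_principalUnits (hl0 : (l : K) ≠ 0) (hl : ‖(l : K)‖ < 1)
    {m : ℕ} (hm : 2 ≤ m) {u : Kˣ} (hu : u ∈ principalUnits (l : K) (m + 1)) :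
    ∃ v ∈ principalUnits (l : K) m, u / v ^ l ∈ principalUnits (l : K) (m + 2) := by
  rw [mem_principalUnits_of_norm_lt_one hl m.succ_ne_zero] at hu
  set t : K := ((u : K) - 1) / l with ht
  have htl : l * t = u - 1 := by rw [ht]; field_simp
  have h0 : 0 < ‖(l : K)‖ := norm_pos_iff.2 hl0
  have htm : ‖t‖ ≤ ‖(l : K)‖ ^ m := by
    rw [ht, norm_div, div_le_iff₀ h0, ← pow_succ]
    exact hu
  have ht1 : ‖t‖ < 1 := htm.trans_lt (pow_lt_one₀ h0.le hl (by lia))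
  have hne : 1 + t ≠ 0 := by
    intro h
    have : t = -1 := by linear_combination h
    simp [this] at ht1
  have hv : Units.mk0 (1 + t) hne ∈ principalUnits (l : K) m :=
    ⟨by simpa using ht1, by simpa using htm⟩
  refine ⟨_, hv, ?_⟩
  set v := Units.mk0 (1 + t) hne with hvdef
  have hvn : ‖((v ^ l : Kˣ) : K)‖ = 1 := norm_eq_one_of_mem_principalUnits (pow_mem hv l)
  rw [mem_principalUnits_of_norm_lt_one hl (by lia)]
  have h1 : ((u / v ^ l : Kˣ) : K) - 1 = -((1 + t) ^ l - 1 - l * t) / ((v ^ l : Kˣ) : K) := by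
    rw [htl, Units.val_div_eq_div_val, div_sub_one (Units.ne_zero _)]
    congr 1
    simp [hvdef]
  rw [h1, norm_div, hvn, div_one, norm_neg]
  calc _ ≤ ‖t‖ ^ 2 := norm_one_add_pow_sub_le l ht1.le
    _ ≤ (‖(l : K)‖ ^ m) ^ 2 := by gcongr
    _ = ‖(l : K)‖ ^ (m * 2) := (pow_mul _ _ _).symm
    _ ≤ _ := pow_le_pow_of_le_one h0.le hl.le (by lia)

theorem exists_div_pow_mem_principalUnits_add (hl0 : (l : K) ≠ 0) (hl : ‖(l : K)‖ < 1)
    {u : Kˣ} (hu : u ∈ principalUnits (l : K) 3) (k : ℕ) :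
    ∃ v ∈ principalUnits (l : K) 2, u / v ^ l ∈ principalUnits (l : K) (k + 3) := by
  induction k with
  | zero => exact ⟨1, one_mem _, by simpa using hu⟩
  | succ k ih =>
    obtain ⟨v, hv, hvu⟩ := ih
    obtain ⟨w, hw, hwu⟩ := exists_div_pow_mem_principalUnits hl0 hl (by lia : 2 ≤ k + 2) hvu
    refine ⟨v * w, mul_mem hv (principalUnits_le hl.le (by lia) hw), ?_⟩
    rwa [mul_pow, ← div_div]

theorem exists_pow_eq_of_mem_principalUnits [ProperSpace K] (hl0 : (l : K) ≠ 0)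
    (hl : ‖(l : K)‖ < 1) {u : Kˣ} (hu : u ∈ principalUnits (l : K) 3) :
    ∃ v ∈ principalUnits (l : K) 2, v ^ l = u := by
  set S : Set K := (· ^ l) '' Metric.closedBall (1 : K) (‖(l : K)‖ ^ 2) with hS
  have hclosed : IsClosed S := ((isCompact_closedBall _ _).image (continuous_pow l)).isClosed
  have hmem : (u : K) ∈ S := by
    rw [← hclosed.closure_eq, Metric.mem_closure_iff]
    intro ε hε
    obtain ⟨k, hk⟩ := exists_pow_lt_of_lt_one hε hl
    obtain ⟨v, hv, hvu⟩ := exists_div_pow_mem_principalUnits_add hl0 hl hu k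
    refine ⟨(v : K) ^ l, ⟨v, by simpa [dist_eq_norm] using hv.2, rfl⟩, ?_⟩
    have hvn : ‖((v ^ l : Kˣ) : K)‖ = 1 := norm_eq_one_of_mem_principalUnits (pow_mem hv l)
    have h1 : (u : K) - (v : K) ^ l = (((u / v ^ l : Kˣ) : K) - 1) * ((v ^ l : Kˣ) : K) := by
      rw [sub_mul, ← Units.val_mul, div_mul_cancel]
      simp
    rw [dist_eq_norm, h1, norm_mul, hvn, mul_one]
    exact (hvu.2.trans (pow_le_pow_of_le_one (norm_nonneg _) hl.le (by lia))).trans_lt hk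
  obtain ⟨x, hx, hxu⟩ := hmem
  rw [mem_closedBall_iff_norm] at hx
  have hx1 : ‖x - 1‖ < 1 := hx.trans_lt (pow_lt_one₀ (norm_nonneg _) hl two_ne_zero)
  have hne : x ≠ 0 := by
    rintro rfl
    simp at hx1
  exact ⟨Units.mk0 x hne, ⟨hx1, hx⟩, Units.ext (by simpa using hxu)⟩

theorem range_powMonoidHom_principalUnits [ProperSpace K] (hl0 : (l : K) ≠ 0)
    (hl : ‖(l : K)‖ < 1) :
    (powMonoidHom l : principalUnits (l : K) 2 →* principalUnits (l : K) 2).range =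
      (principalUnits (l : K) 3).subgroupOf (principalUnits (l : K) 2) := by
  ext u
  rw [Subgroup.mem_subgroupOf]
  constructor
  · rintro ⟨v, rfl⟩
    exact pow_mem_principalUnits hl two_ne_zero v.2
  · intro hu
    obtain ⟨v, hv, hvu⟩ := exists_pow_eq_of_mem_principalUnits hl0 hl hu
    exact ⟨⟨v, hv⟩, Subtype.ext hvu⟩

end NatCast

/-- The homomorphism `(n, u) ↦ π ^ n * u`. -/
def zpowMulPrincipalUnits (π : Kˣ) (m : ℕ) :
    Multiplicative ℤ × principalUnits (π : K) m →* Kˣ :=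
  (zpowersHom Kˣ π).coprod (principalUnits (π : K) m).subtype

theorem zpowMulPrincipalUnits_apply (π : Kˣ) (m : ℕ) (n : Multiplicative ℤ)
    (u : principalUnits (π : K) m) :
    zpowMulPrincipalUnits π m (n, u) = π ^ n.toAdd * u := rfl

theorem zpowMulPrincipalUnits_injective {π : Kˣ} (hπ : ‖(π : K)‖ < 1) (m : ℕ) :
    Function.Injective (zpowMulPrincipalUnits π m) := by
  rw [injective_iff_map_eq_one]
  rintro ⟨n, u⟩ h
  rw [zpowMulPrincipalUnits_apply] at h
  have h1 := congrArg (fun x : Kˣ ↦ ‖(x : K)‖) h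
  simp only [Units.val_mul, norm_mul, norm_eq_one_of_mem_principalUnits u.2, mul_one,
    Units.val_zpow_eq_zpow_val, norm_zpow, Units.val_one, norm_one] at h1
  have hn : n.toAdd = 0 := (zpow_eq_one_iff_right₀ (norm_nonneg _) hπ.ne).1 h1
  rw [hn, zpow_zero, one_mul] at h
  exact Prod.ext hn (Subtype.ext h)

theorem finiteIndex_range_zpowMulPrincipalUnits [ProperSpace K] {π : Kˣ} (hπ : ‖(π : K)‖ < 1)
    (m : ℕ) : (zpowMulPrincipalUnits π m).range.FiniteIndex := by
  set c := ‖(π : K)‖ with hc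
  have hc0 : 0 < c := norm_pos_iff.2 π.ne_zero
  obtain ⟨t, -, htfin, ht⟩ := (isCompact_closedBall (0 : K) 1).finite_cover_balls
    (show 0 < c ^ (m + 2) by positivity)
  have key : ∀ x : Kˣ, ∃ y ∈ t, ∃ hy : y ≠ 0, (Units.mk0 y hy)⁻¹ * x ∈
      (zpowMulPrincipalUnits π m).range := by
    intro x
    obtain ⟨n, hn1, hn2⟩ := exists_mem_Ioc_zpow (norm_pos_iff.2 x.ne_zero) ((one_lt_inv₀ hc0).2 hπ)
    set z : Kˣ := π ^ (n + 1) * x with hz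
    have hzn : ‖(z : K)‖ = c ^ (n + 1) * ‖(x : K)‖ := by
      simp [hz, hc, Units.val_zpow_eq_zpow_val, norm_mul, norm_zpow]
    have hzle : ‖(z : K)‖ ≤ 1 := by
      rw [hzn]
      calc _ ≤ c ^ (n + 1) * c⁻¹ ^ (n + 1) := by gcongr
        _ = 1 := by rw [inv_zpow, mul_inv_cancel₀ (by positivity)]
    have hzgt : c < ‖(z : K)‖ := by
      rw [hzn]
      calc c = c ^ (n + 1) * c⁻¹ ^ n := by
            rw [inv_zpow, zpow_add_one₀ hc0.ne']
            field_simp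
        _ < _ := by gcongr
    obtain ⟨y, hyt, hy⟩ := Set.mem_iUnion₂.1 (ht (by simpa using hzle : (z : K) ∈ _))
    rw [mem_ball_iff_norm] at hy
    have hlt : ‖(z : K) - y‖ < ‖(z : K)‖ := by
      refine (hy.trans_le ?_).trans hzgt
      exact pow_le_of_le_one hc0.le hπ.le (by lia)
    have hyz : ‖y‖ = ‖(z : K)‖ := by
      have := IsUltrametricDist.norm_add_eq_max_of_norm_ne_norm (x := (z : K)) (y := -((z : K) - y))
        (by rw [norm_neg]; exact hlt.ne')
      rw [norm_neg, max_eq_left hlt.le] at this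
      rw [← this]
      congr 1
      ring
    have hy0 : y ≠ 0 := by
      rw [← norm_pos_iff, hyz]
      exact norm_pos_iff.2 z.ne_zero
    refine ⟨y, hyt, hy0, ?_⟩
    have hmem : (Units.mk0 y hy0)⁻¹ * z ∈ principalUnits (π : K) m := by
      have h1 : (((Units.mk0 y hy0)⁻¹ * z : Kˣ) : K) - 1 = (z - y) / y := by
        simp
        field_simp
      have h2 : ‖(((Units.mk0 y hy0)⁻¹ * z : Kˣ) : K) - 1‖ ≤ c ^ (m + 1) := by
        rw [h1, norm_div, div_le_iff₀ (norm_pos_iff.2 hy0), hyz]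
        calc _ ≤ c ^ (m + 2) := hy.le
          _ = c ^ (m + 1) * c := pow_succ _ _
          _ ≤ _ := by gcongr
      exact ⟨h2.trans_lt (pow_lt_one₀ hc0.le hπ (by lia)),
        h2.trans (pow_le_pow_of_le_one hc0.le hπ.le (by lia))⟩
    refine ⟨(.ofAdd (-(n + 1)), ⟨_, hmem⟩), ?_⟩
    rw [zpowMulPrincipalUnits_apply]
    change π ^ (-(n + 1)) * ((Units.mk0 y hy0)⁻¹ * z) = _
    rw [hz, mul_left_comm, zpow_neg, inv_mul_cancel_left]
  classical
  have : Finite t := htfin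
  let f : t → Kˣ ⧸ (zpowMulPrincipalUnits π m).range := fun y ↦
    if hy : (y : K) ≠ 0 then (Units.mk0 (y : K) hy : Kˣ) else 1
  have hf : Function.Surjective f := by
    intro q
    obtain ⟨x, rfl⟩ := QuotientGroup.mk_surjective q
    obtain ⟨y, hyt, hy0, h⟩ := key x
    refine ⟨⟨y, hyt⟩, ?_⟩
    simp only [f, dif_pos hy0]
    exact QuotientGroup.eq.2 h
  have := Finite.of_surjective f hf
  exact Subgroup.finiteIndex_of_finite_quotient

end Ultrametric

section Padic

variable {l : ℕ} [Fact l.Prime] {K : Type*} [NormedField K] [NormedAlgebra ℚ_[l] K]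

theorem norm_natCast_prime_of_normedAlgebra_padic : ‖(l : K)‖ = (l : ℝ)⁻¹ := by
  rw [← map_natCast (algebraMap ℚ_[l] K), norm_algebraMap', Padic.norm_p]

variable [FiniteDimensional ℚ_[l] K]

section IntegralClosure

variable [Algebra ℤ_[l] K] [IsScalarTower ℤ_[l] ℚ_[l] K]

theorem mem_integralClosure_padicInt_iff_norm_le_one {x : K} :
    x ∈ integralClosure ℤ_[l] K ↔ ‖x‖ ≤ 1 := by
  have hx : IsIntegral ℚ_[l] x := .of_finite ℚ_[l] x
  rw [mem_integralClosure_iff, NormedAlgebra.norm_eq_spectralNorm ℚ_[l] x, spectralNorm,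
    spectralValue_le_one_iff (minpoly.monic hx)]
  constructor
  · intro h n
    rw [minpoly.isIntegrallyClosed_eq_field_fractions' ℚ_[l] h, Polynomial.coeff_map]
    exact PadicInt.norm_le_one _
  · intro h
    have hlift : minpoly ℚ_[l] x ∈ Polynomial.lifts (algebraMap ℤ_[l] ℚ_[l]) := by
      rw [Polynomial.lifts_iff_coeff_lifts]
      exact fun n ↦ ⟨⟨_, h n⟩, rfl⟩
    obtain ⟨q, hq, -, hqm⟩ := Polynomial.lifts_and_natDegree_eq_and_monic hlift (minpoly.monic hx)
    refine ⟨q, hqm, ?_⟩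
    rw [← Polynomial.aeval_def, ← Polynomial.aeval_map_algebraMap ℚ_[l], hq, minpoly.aeval]

theorem PadicInt.toZMod_eq_zero_iff_dvd {x : ℤ_[l]} : PadicInt.toZMod x = 0 ↔ (l : ℤ_[l]) ∣ x := by
  rw [← RingHom.mem_ker, PadicInt.ker_toZMod, PadicInt.maximalIdeal_eq_span_p,
    Ideal.mem_span_singleton]

variable (l K) in
/-- The reduction modulo `l` of the ring of integers of `K`, in coordinates. -/
theorem exists_integralClosure_padicInt_surjective :
    ∃ f : integralClosure ℤ_[l] K →+ (Fin (Module.finrank ℚ_[l] K) → ZMod l),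
      Function.Surjective f ∧ ∀ x, f x = 0 ↔ ‖(x : K)‖ ≤ ‖(l : K)‖ := by
  have : Module.IsTorsionFree ℤ_[l] K := .trans_faithfulSMul ℤ_[l] ℚ_[l] K
  have : Module.Free ℤ_[l] (integralClosure ℤ_[l] K) := IsIntegralClosure.module_free _ ℚ_[l] K _
  have : Module.Finite ℤ_[l] (integralClosure ℤ_[l] K) := IsIntegralClosure.finite _ ℚ_[l] K _
  let b := Module.finBasisOfFinrankEq ℤ_[l] (integralClosure ℤ_[l] K)
    (IsIntegralClosure.rank ℤ_[l] ℚ_[l] K (integralClosure ℤ_[l] K))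
  have hl : 0 < ‖(l : K)‖ := by
    rw [norm_natCast_prime_of_normedAlgebra_padic]
    have := (Fact.out : l.Prime).pos
    positivity
  refine ⟨((PadicInt.toZMod (p := l)).toAddMonoidHom.compLeft _).comp
    b.equivFun.toLinearMap.toAddMonoidHom, fun v ↦ ?_, fun x ↦ ?_⟩
  · choose w hw using fun i ↦ ZMod.ringHom_surjective (PadicInt.toZMod (p := l)) (v i)
    obtain ⟨y, rfl⟩ := b.equivFun.surjective w
    exact ⟨y, funext hw⟩
  · have h1 : (∀ i, (l : ℤ_[l]) ∣ b.repr x i) ↔ ∃ y, x = (l : ℤ_[l]) • y := by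
      constructor
      · intro h
        choose w hw using h
        obtain ⟨y, rfl⟩ := b.equivFun.surjective w
        exact ⟨y, b.equivFun.injective (funext fun i ↦ by simpa using hw i)⟩
      · rintro ⟨y, rfl⟩ i
        simp
    have h2 : (∃ y, x = (l : ℤ_[l]) • y) ↔ ‖(x : K)‖ ≤ ‖(l : K)‖ := by
      constructor
      · rintro ⟨y, rfl⟩
        have hy := mem_integralClosure_padicInt_iff_norm_le_one.1 y.2
        rw [Algebra.smul_def, map_natCast]
        simpa using mul_le_of_le_one_right hl.le hy
      · intro h
        have hy : (x : K) / l ∈ integralClosure ℤ_[l] K := by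
          rw [mem_integralClosure_padicInt_iff_norm_le_one, norm_div]
          exact div_le_one_of_le₀ h hl.le
        refine ⟨⟨_, hy⟩, Subtype.ext ?_⟩
        rw [Algebra.smul_def, map_natCast]
        simp [mul_div_cancel₀ _ (norm_pos_iff.1 hl)]
    rw [← h2, ← h1, funext_iff]
    simp [PadicInt.toZMod_eq_zero_iff_dvd]

end IntegralClosure

variable (l K) in
theorem relIndex_principalUnits_succ [IsUltrametricDist K] {m : ℕ} (hm : m ≠ 0) :
    (principalUnits (l : K) (m + 1)).relIndex (principalUnits (l : K) m) =
      l ^ Module.finrank ℚ_[l] K := by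
  let : Algebra ℤ_[l] K := ((algebraMap ℚ_[l] K).comp (algebraMap ℤ_[l] ℚ_[l])).toAlgebra
  have : IsScalarTower ℤ_[l] ℚ_[l] K := .of_algebraMap_eq fun _ ↦ rfl
  obtain ⟨f, hf, hf0⟩ := exists_integralClosure_padicInt_surjective l K
  have hlp : 1 < (l : ℝ) := by exact_mod_cast (Fact.out : l.Prime).one_lt
  have hl : ‖(l : K)‖ < 1 := by
    rw [norm_natCast_prime_of_normedAlgebra_padic]
    exact inv_lt_one_of_one_lt₀ hlp
  have h0 : 0 < ‖(l : K)‖ := by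
    rw [norm_natCast_prime_of_normedAlgebra_padic]
    positivity
  have hl0 : (l : K) ≠ 0 := norm_pos_iff.1 h0
  have hint : ∀ u ∈ principalUnits (l : K) m,
      ((u : K) - 1) / (l : K) ^ m ∈ integralClosure ℤ_[l] K := by
    intro u hu
    rw [mem_integralClosure_padicInt_iff_norm_le_one, norm_div, norm_pow]
    exact div_le_one_of_le₀ hu.2 (by positivity)
  let g : principalUnits (l : K) m →* Multiplicative (Fin (Module.finrank ℚ_[l] K) → ZMod l) :=
    MonoidHom.mk' (fun u ↦ .ofAdd (f ⟨_, hint u u.2⟩)) <| by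
      intro u v
      rw [← ofAdd_add, ← map_add]
      congr 1
      rw [← sub_eq_zero, ← map_sub, hf0]
      have h1 : (((u * v : principalUnits (l : K) m) : Kˣ) - 1 : K) / (l : K) ^ m -
          ((((u : Kˣ) : K) - 1) / (l : K) ^ m + (((v : Kˣ) : K) - 1) / (l : K) ^ m) =
          (((u : Kˣ) : K) - 1) * (((v : Kˣ) : K) - 1) / (l : K) ^ m := by
        push_cast
        field_simp
        ring
      change ‖(((u * v : principalUnits (l : K) m) : Kˣ) - 1 : K) / (l : K) ^ m -
          ((((u : Kˣ) : K) - 1) / (l : K) ^ m + (((v : Kˣ) : K) - 1) / (l : K) ^ m)‖ ≤ _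
      rw [h1, norm_div, norm_mul, norm_pow, div_le_iff₀ (by positivity), mul_comm ‖(l : K)‖]
      refine mul_le_mul u.2.2 (v.2.2.trans ?_) (norm_nonneg _) (by positivity)
      exact pow_le_of_le_one h0.le hl.le hm
  have hker : g.ker = (principalUnits (l : K) (m + 1)).subgroupOf (principalUnits (l : K) m) := by
    ext u
    rw [MonoidHom.mem_ker, Subgroup.mem_subgroupOf,
      mem_principalUnits_of_norm_lt_one hl m.succ_ne_zero]
    change f ⟨_, hint u u.2⟩ = 0 ↔ _
    rw [hf0, norm_div, norm_pow, div_le_iff₀ (by positivity), ← pow_succ']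
  have hsurj : Function.Surjective g := by
    intro v
    obtain ⟨x, hx⟩ := hf v.toAdd
    have hx1 := mem_integralClosure_padicInt_iff_norm_le_one.1 x.2
    have hle : ‖(l : K) ^ m * x‖ ≤ ‖(l : K)‖ ^ m := by
      rw [norm_mul, norm_pow]
      exact mul_le_of_le_one_right (by positivity) hx1
    have hlt := hle.trans_lt (pow_lt_one₀ h0.le hl hm)
    have hne : 1 + (l : K) ^ m * x ≠ 0 := by
      intro h
      rw [show (l : K) ^ m * x = -1 by linear_combination h] at hlt
      simp at hlt
    have hmem : Units.mk0 _ hne ∈ principalUnits (l : K) m :=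
      ⟨by simpa using hlt, by simpa using hle⟩
    refine ⟨⟨_, hmem⟩, ?_⟩
    refine Multiplicative.toAdd.injective ?_
    rw [← hx]
    change f _ = f _
    congr 1
    refine Subtype.ext ?_
    simp [hl0]
  rw [Subgroup.relIndex, ← hker, Subgroup.index_ker, MonoidHom.range_eq_top.2 hsurj,
    Subgroup.card_top, Nat.card_congr Multiplicative.toAdd]
  simp

theorem card_units_quot_range_powMonoidHom_of_normedField [IsUltrametricDist K]
    (hζ : ∃ ζ : Kˣ, orderOf ζ = l) :
    Nat.card (Kˣ ⧸ (powMonoidHom l : Kˣ →* Kˣ).range) = l ^ (2 + Module.finrank ℚ_[l] K) := by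
  have : ProperSpace K := FiniteDimensional.proper ℚ_[l] K
  have hlp : 1 < (l : ℝ) := by exact_mod_cast (Fact.out : l.Prime).one_lt
  have hl : ‖(l : K)‖ < 1 := by
    rw [norm_natCast_prime_of_normedAlgebra_padic]
    exact inv_lt_one_of_one_lt₀ hlp
  have hl0 : (l : K) ≠ 0 := by
    rw [← norm_pos_iff, norm_natCast_prime_of_normedAlgebra_padic]
    positivity
  have := finiteIndex_range_zpowMulPrincipalUnits (π := Units.mk0 (l : K) hl0) hl 2
  obtain ⟨ζ, hζ⟩ := hζ
  have : NeZero l := ⟨(Fact.out : l.Prime).ne_zero⟩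
  have hker : Nat.card (powMonoidHom l : Kˣ →* Kˣ).ker = l :=
    ((IsPrimitiveRoot.iff_orderOf (k := l)).2 hζ).card_rootsOfUnity'
  rw [← Subgroup.index_eq_card, MonoidHom.index_range_powMonoidHom_of_injective l _
    (zpowMulPrincipalUnits_injective (π := Units.mk0 (l : K) hl0) hl 2), hker,
    index_range_powMonoidHom_prod, index_range_powMonoidHom_multiplicative_int]
  · change l * (powMonoidHom l : principalUnits (l : K) 2 →* principalUnits (l : K) 2).range.index *
      l = _
    rw [range_powMonoidHom_principalUnits hl0 hl, ← Subgroup.relIndex,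
      relIndex_principalUnits_succ l K two_ne_zero]
    ring
  · rintro ⟨n, u⟩ h
    have hn : n ^ l = 1 := congrArg Prod.fst h
    have hu : (u : Kˣ) ^ l = 1 := congrArg Subtype.val (congrArg Prod.snd h)
    refine Prod.ext ?_ (Subtype.ext (eq_one_of_mem_principalUnits_of_pow_eq_one hl0 hl u.2 hu))
    exact (pow_eq_one_iff_left (NeZero.ne l)).1 hn

end Padic

/-- If `K` is a finite extension of `ℚ_l` of degree `d` containing a primitive
`l`-th root of unity, where `l` is prime, then `Kˣ/(Kˣ)^l` has cardinality `l^(2+d)`. -/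
theorem card_units_quot_lth_powers_of_local_field_wild
    (l : ℕ) [Fact l.Prime]
    (K : Type*) [Field K] [Algebra ℚ_[l] K] [FiniteDimensional ℚ_[l] K]
    (hζ : ∃ ζ : Kˣ, orderOf ζ = l) :
    Nat.card (Kˣ ⧸ (powMonoidHom l : Kˣ →* Kˣ).range) = l ^ (2 + Module.finrank ℚ_[l] K) := by
  let := spectralNorm.normedField ℚ_[l] K
  let := spectralNorm.normedAlgebra ℚ_[l] K
  have : IsUltrametricDist K := IsUltrametricDist.of_normedAlgebra ℚ_[l]
  exact card_units_quot_range_powMonoidHom_of_normedField hζ
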